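/- arXiv:1507.04986 — 2 statements merged into one kernel-verified Lean document; each statement's English description precedes it below -/
import Mathlib

section
/- Let 0<s<1 and let m ≥ 1 be an integer. Then ∫_0^∞ e^{−2t} I_m(2t) t^{−1−s} dt = 4^s Γ(1/2+s) Γ(m−s) / (√π Γ(m+1+s)), where I_m is the modified Bessel function of the first kind of integer order m, defined by the everywhere-convergent power series I_m(x) = ∑_{k=0}^{∞} (x/2)^{2k+m} / (k! (k+m)!). -/
open Real MeasureTheory

/-- The modified Bessel function of the first kind of integer order `m ≥ 0`,
defined by its everywhere-convergent power series. -/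
noncomputable def besselI (m : ℕ) (x : ℝ) : ℝ :=
  ∑' k : ℕ, (x / 2) ^ (2 * k + m) / ((k.factorial : ℝ) * ((k + m).factorial : ℝ))

theorem hasSum_integral_of_nonneg_of_integrable {α : Type*} [MeasurableSpace α] {μ : Measure α}
    {F : ℕ → α → ℝ} {f : α → ℝ} (hF : ∀ n, AEStronglyMeasurable (F n) μ)
    (h0 : ∀ n, ∀ᵐ x ∂μ, 0 ≤ F n x) (hsum : ∀ᵐ x ∂μ, HasSum (fun n => F n x) (f x))
    (hf : Integrable f μ) : HasSum (fun n => ∫ x, F n x ∂μ) (∫ x, f x ∂μ) := by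
  refine hasSum_integral_of_dominated_convergence F hF
    (fun n => (h0 n).mono fun x hx => (Real.norm_of_nonneg hx).le)
    (hsum.mono fun x hx => hx.summable) (hf.congr ?_) hsum
  filter_upwards [hsum] with x hx using hx.tsum_eq.symm

theorem integrableOn_rpow_mul_exp_neg_mul {a r : ℝ} (ha : 0 < a) (hr : 0 < r) :
    IntegrableOn (fun t : ℝ => t ^ (a - 1) * Real.exp (-(r * t))) (Set.Ioi 0) :=
  .of_integral_ne_zero (by
    rw [Real.integral_rpow_mul_exp_neg_mul_Ioi ha hr]
    have := Real.Gamma_pos_of_pos ha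
    positivity)

theorem integral_rpow_mul_one_sub_rpow {u v : ℝ} (hu : 0 < u) (hv : 0 < v) :
    ∫ x in Set.Ioo (0 : ℝ) 1, x ^ (u - 1) * (1 - x) ^ (v - 1) =
      Real.Gamma u * Real.Gamma v / Real.Gamma (u + v) := by
  change _ = ProbabilityTheory.beta u v
  rw [ProbabilityTheory.beta_eq_betaIntegralReal u v hu hv, Complex.betaIntegral,
    intervalIntegral.integral_of_le zero_le_one, ← integral_Ioc_eq_integral_Ioo,
    ← RCLike.re_to_complex, ← integral_re]
  · refine setIntegral_congr_fun measurableSet_Ioc fun x ⟨hx1, hx2⟩ ↦ ?_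
    norm_cast
    rw [← Complex.ofReal_cpow hx1.le, ← Complex.ofReal_cpow (by linarith), RCLike.re_to_complex,
      Complex.re_mul_ofReal, Complex.ofReal_re]
  · convert! Complex.betaIntegral_convergent (u := u) (v := v) (by simpa) (by simpa)
    rw [intervalIntegrable_iff_integrableOn_Ioc_of_le zero_le_one, IntegrableOn]

theorem integrableOn_rpow_mul_one_sub_rpow {u v : ℝ} (hu : 0 < u) (hv : 0 < v) :
    IntegrableOn (fun x : ℝ => x ^ (u - 1) * (1 - x) ^ (v - 1)) (Set.Ioo 0 1) :=
  .of_integral_ne_zero (by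
    rw [integral_rpow_mul_one_sub_rpow hu hv]
    exact (ProbabilityTheory.beta_pos hu hv).ne')

/-- The binomial series of `(1 - x) ^ (-a)`, with Gamma-function coefficients. -/
theorem hasSum_Gamma_add_nat_mul_pow_div_factorial {a x : ℝ} (ha : 0 < a) (hx0 : 0 ≤ x)
    (hx1 : x < 1) :
    HasSum (fun k : ℕ => Real.Gamma (a + k) * x ^ k / k.factorial)
      (Real.Gamma a * (1 - x) ^ (-a)) := by
  have hr : 0 < 1 - x := by linarith
  have key := hasSum_integral_of_nonneg_of_integrable (μ := volume.restrict (Set.Ioi (0 : ℝ)))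
    (F := fun (k : ℕ) t => x ^ k / k.factorial * (t ^ (a + k - 1) * Real.exp (-(1 * t))))
    (f := fun t => t ^ (a - 1) * Real.exp (-((1 - x) * t)))
    (fun k => ((integrableOn_rpow_mul_exp_neg_mul (a := a + k) (by positivity)
      one_pos).const_mul _).1)
    (fun k => ae_restrict_of_forall_mem measurableSet_Ioi fun t (ht : 0 < t) => by positivity)
    (ae_restrict_of_forall_mem measurableSet_Ioi fun t (ht : 0 < t) => ?_)
    (integrableOn_rpow_mul_exp_neg_mul ha hr)
  · rw [Real.integral_rpow_mul_exp_neg_mul_Ioi ha hr, one_div, Real.inv_rpow hr.le,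
      ← Real.rpow_neg hr.le, mul_comm] at key
    refine key.congr_fun fun k => ?_
    rw [integral_const_mul, Real.integral_rpow_mul_exp_neg_mul_Ioi (by positivity) one_pos]
    simp only [div_one, Real.one_rpow, one_mul]
    ring
  · have h := (NormedSpace.expSeries_div_hasSum_exp (x * t)).mul_left
      (t ^ (a - 1) * Real.exp (-(1 * t)))
    rw [← Real.exp_eq_exp_ℝ, mul_assoc, ← Real.exp_add] at h
    convert! h using 1
    · ext k
      rw [show a + k - 1 = a - 1 + k by ring, Real.rpow_add ht, Real.rpow_natCast, mul_pow]
      ring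
    · ring_nf

/-- The **Gauss summation theorem** for the hypergeometric series at `1`, in Gamma-function form. -/
theorem hasSum_Gamma_mul_Gamma_div_Gamma {a b c : ℝ} (ha : 0 < a) (hb : 0 < b)
    (hc : a + b < c) :
    HasSum (fun k : ℕ => Real.Gamma (a + k) * Real.Gamma (b + k) /
        (k.factorial * Real.Gamma (c + k)))
      (Real.Gamma a * Real.Gamma b * Real.Gamma (c - a - b) /
        (Real.Gamma (c - a) * Real.Gamma (c - b))) := by
  have hcb : 0 < c - b := by linarith
  have hcab : 0 < c - a - b := by linarith
  have hG := (Real.Gamma_pos_of_pos hcb).ne'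
  have key := hasSum_integral_of_nonneg_of_integrable (μ := volume.restrict (Set.Ioo (0 : ℝ) 1))
    (F := fun (k : ℕ) x => Real.Gamma (a + k) / k.factorial *
      (x ^ (b + k - 1) * (1 - x) ^ (c - b - 1)))
    (f := fun x => Real.Gamma a * (x ^ (b - 1) * (1 - x) ^ (c - a - b - 1)))
    (fun k => ((integrableOn_rpow_mul_one_sub_rpow (u := b + k) (by positivity) hcb).const_mul _).1)
    (fun k => ae_restrict_of_forall_mem measurableSet_Ioo fun x ⟨hx0, hx1⟩ => ?_)
    (ae_restrict_of_forall_mem measurableSet_Ioo fun x ⟨hx0, hx1⟩ => ?_)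
    ((integrableOn_rpow_mul_one_sub_rpow hb hcab).const_mul _)
  · rw [integral_const_mul, integral_rpow_mul_one_sub_rpow hb hcab,
      show b + (c - a - b) = c - a by ring] at key
    convert! key.mul_left (Real.Gamma (c - b))⁻¹ using 1
    · ext k
      rw [integral_const_mul, integral_rpow_mul_one_sub_rpow (by positivity) hcb,
        show b + k + (c - b) = c + k by ring]
      field_simp
    · field_simp
  · have := Real.Gamma_pos_of_pos (show 0 < a + k by positivity)
    have : 0 < 1 - x := by linarith
    positivity
  · have hx : 0 < 1 - x := by linarith
    convert! (hasSum_Gamma_add_nat_mul_pow_div_factorial ha hx0.le hx1).mul_left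
      (x ^ (b - 1) * (1 - x) ^ (c - b - 1)) using 1
    · ext k
      rw [show b + k - 1 = b - 1 + k by ring, Real.rpow_add hx0, Real.rpow_natCast]
      ring
    · rw [show c - a - b - 1 = c - b - 1 + -a by ring, Real.rpow_add hx]
      ring

/-- The Mellin transforms of the terms of `exp (-2 * t) * besselI m (2 * t)` sum to the
closed form. -/
theorem hasSum_Gamma_div_two_rpow {s : ℝ} {m : ℕ} (hs0 : 0 < s) (hsm : s < m) :
    HasSum (fun k : ℕ => Real.Gamma (2 * k + m - s) * (1 / 2) ^ (2 * k + m - s) /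
        (k.factorial * (k + m).factorial))
      (4 ^ s * Real.Gamma (1 / 2 + s) * Real.Gamma (m - s) /
        (Real.sqrt Real.pi * Real.Gamma (m + 1 + s))) := by
  have half_rpow (z : ℝ) : ((1 : ℝ) / 2) ^ z = 2 ^ (-z) := by
    rw [one_div, Real.inv_rpow zero_le_two, Real.rpow_neg zero_le_two]
  have hpi : Real.sqrt Real.pi ≠ 0 := (Real.sqrt_pos.2 Real.pi_pos).ne'
  have h := (hasSum_Gamma_mul_Gamma_div_Gamma (a := (m - s) / 2) (b := (m - s) / 2 + 1 / 2)
    (c := m + 1) (by linarith) (by linarith) (by linarith)).mul_left (2 * Real.sqrt Real.pi)⁻¹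
  convert! h using 1
  · ext k
    rw [show (m - s) / 2 + 1 / 2 + k = ((m - s) / 2 + k) + 1 / 2 by ring,
      Real.Gamma_mul_Gamma_add_half, show (m : ℝ) + 1 + k = ((k + m : ℕ) : ℝ) + 1 by push_cast; ring,
      Real.Gamma_nat_eq_factorial, half_rpow,
      show 1 - 2 * ((m - s) / 2 + k) = 1 + -(2 * k + m - s) by ring,
      Real.rpow_add two_pos, Real.rpow_one,
      show 2 * ((m - s) / 2 + k) = 2 * k + m - s by ring]
    field_simp
  · rw [show m + 1 - (m - s) / 2 - ((m - s) / 2 + 1 / 2) = 1 / 2 + s by ring,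
      Real.Gamma_mul_Gamma_add_half, mul_comm (Real.Gamma (m + 1 - (m - s) / 2)),
      show (m : ℝ) + 1 - (m - s) / 2 = (m + 1 - ((m - s) / 2 + 1 / 2)) + 1 / 2 by ring,
      Real.Gamma_mul_Gamma_add_half,
      show 2 * (m + 1 - ((m - s) / 2 + 1 / 2)) = m + 1 + s by ring,
      show 2 * ((m - s) / 2) = m - s by ring,
      show (4 : ℝ) = 2 ^ (2 : ℝ) by norm_num, ← Real.rpow_mul zero_le_two,
      show 1 - (m - s) = 2 * s + (1 - (m + 1 + s)) + 1 by ring,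
      Real.rpow_add two_pos, Real.rpow_add two_pos, Real.rpow_one]
    have := Real.Gamma_pos_of_pos (show 0 < (m : ℝ) + 1 + s by positivity)
    field_simp

theorem bessel_integral_fracLap (s : ℝ) (hs0 : 0 < s) (hs1 : s < 1) (m : ℕ) (hm : 1 ≤ m) :
    ∫ t in Set.Ioi (0 : ℝ), Real.exp (-2 * t) * besselI m (2 * t) * t ^ (-1 - s) =
      4 ^ s * Real.Gamma (1 / 2 + s) * Real.Gamma ((m : ℝ) - s) /
        (Real.sqrt Real.pi * Real.Gamma ((m : ℝ) + 1 + s)) := by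
  have hm' : (1 : ℝ) ≤ m := by exact_mod_cast hm
  have hsum := hasSum_Gamma_div_two_rpow hs0 (hs1.trans_le hm')
  have hpos (k : ℕ) : 0 < 2 * (k : ℝ) + m - s := by
    have : (0 : ℝ) ≤ k := k.cast_nonneg
    linarith
  let F (k : ℕ) (t : ℝ) : ℝ := ((k.factorial : ℝ) * (k + m).factorial)⁻¹ *
    (t ^ (2 * k + m - s - 1) * Real.exp (-(2 * t)))
  have hF (k : ℕ) : ∫ t in Set.Ioi (0 : ℝ), F k t =
      Real.Gamma (2 * k + m - s) * (1 / 2) ^ (2 * k + m - s) /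
        (k.factorial * (k + m).factorial) := by
    rw [integral_const_mul, Real.integral_rpow_mul_exp_neg_mul_Ioi (hpos k) two_pos]
    ring
  have hnorm (k : ℕ) : ∫ t in Set.Ioi (0 : ℝ), ‖F k t‖ = ∫ t in Set.Ioi (0 : ℝ), F k t :=
    setIntegral_congr_fun measurableSet_Ioi fun t (ht : 0 < t) =>
      Real.norm_of_nonneg (by positivity)
  have key := hasSum_integral_of_summable_integral_norm
    (μ := volume.restrict (Set.Ioi (0 : ℝ))) (F := F)
    (fun k => (integrableOn_rpow_mul_exp_neg_mul (hpos k) two_pos).const_mul _)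
    (by simpa only [hnorm, hF] using hsum.summable)
  simp only [hF] at key
  rw [← key.unique hsum]
  refine setIntegral_congr_fun measurableSet_Ioi fun t (ht : 0 < t) => ?_
  simp only [besselI, F]
  rw [← tsum_mul_left, ← tsum_mul_right]
  refine tsum_congr fun k => ?_
  rw [show 2 * (k : ℝ) + m - s - 1 = ((2 * k + m : ℕ) : ℝ) + (-1 - s) by push_cast; ring,
    Real.rpow_add ht, Real.rpow_natCast, mul_div_cancel_left₀ t two_ne_zero, neg_mul]
  ring
end

section
/- Let n ≥ 1 be an integer, let 0<s with 2s<n, and let γ>0. Let f(y) = (1 − ‖y‖₂²)_+^{γ/2} for y ∈ ℝⁿ, where t_+ = max{t,0}. Then for every x ∈ ℝⁿ with ‖x‖₂ ≤ 1, the Riesz potential (−Δ)^{−s} f(x) := (Γ((n−2s)/2) / (4^s π^{n/2} Γ(s))) ∫_{ℝⁿ} f(y) ‖x−y‖₂^{2s−n} dy equals C_{γ,s,n} · ∑_{k=0}^{∞} [((n−2s)/2)_k (−(γ+2s)/2)_k / ((n/2)_k k!)] ‖x‖₂^{2k}, where C_{γ,s,n} = 2^{−2s} Γ((n−2s)/2)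 Γ(γ/2+1) / (Γ((2s+γ)/2+1) Γ(n/2)) and (a)_k = a(a+1)⋯(a+k−1) denotes the rising (Pochhammer) factorial; the series converges absolutely for ‖x‖₂ ≤ 1. -/
open Real MeasureTheory Polynomial

theorem summable_abs_ascPochhammer_eval_neg_div_factorial {q : ℝ} (hq : 0 < q) :
    Summable (fun k : ℕ => |(ascPochhammer ℝ k).eval (-q) / (k.factorial : ℝ)|) := by
  set c : ℕ → ℝ := fun k => |(ascPochhammer ℝ k).eval (-q) / (k.factorial : ℝ)| with hc
  obtain ⟨N, hN⟩ := exists_nat_ge q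
  have hc0 : ∀ k, 0 ≤ c k := fun k => abs_nonneg _
  have hstep : ∀ k, N ≤ k → q * c k = k * c k - (k + 1 : ℕ) * c (k + 1) := by
    intro k hk
    have hkq : 0 ≤ -q + k := by
      have : (N : ℝ) ≤ k := by exact_mod_cast hk
      linarith
    have : c (k + 1) = c k * ((-q + k) / (k + 1)) := by
      simp only [hc]
      rw [ascPochhammer_succ_eval, Nat.factorial_succ, abs_div, abs_mul, abs_of_nonneg hkq,
        abs_div, abs_of_nonneg (a := ((k.factorial : ℕ) : ℝ)) (by positivity),
        abs_of_nonneg (a := (((k + 1) * k.factorial : ℕ) : ℝ)) (by positivity)]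
      push_cast
      field_simp
    rw [this]
    push_cast
    field_simp
    ring
  rw [← summable_nat_add_iff N]
  refine summable_of_sum_range_le (c := N * c N / q) (fun k => hc0 _) fun m => ?_
  rw [le_div_iff₀ hq, mul_comm, Finset.mul_sum]
  have : ∀ m, ∑ i ∈ Finset.range m, q * c (i + N) = N * c N - (m + N : ℕ) * c (m + N) := by
    intro m
    induction m with
    | zero => simp
    | succ m ih =>
      rw [Finset.sum_range_succ, ih, hstep _ (Nat.le_add_left N m)]
      rw [show m + 1 + N = m + N + 1 by ring]
      ring
  rw [this]
  have := mul_nonneg (Nat.cast_nonneg (α := ℝ) (m + N)) (hc0 (m + N))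
  linarith

theorem ascPochhammer_eval_div_eval_mem_Icc {a b : ℝ} (ha : 0 < a) (hab : a ≤ b) (k : ℕ) :
    (ascPochhammer ℝ k).eval a / (ascPochhammer ℝ k).eval b ∈ Set.Icc 0 1 := by
  have hb := ha.trans_le hab
  refine ⟨(div_pos (ascPochhammer_pos k a ha) (ascPochhammer_pos k b hb)).le,
    (div_le_one (ascPochhammer_pos k b hb)).2 ?_⟩
  induction k with
  | zero => simp
  | succ k ih =>
    rw [ascPochhammer_succ_eval, ascPochhammer_succ_eval]
    have := ascPochhammer_pos k b hb
    gcongr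

theorem Real.hasSum_one_sub_rpow (q : ℝ) {w : ℝ} (hw : |w| < 1) :
    HasSum (fun k : ℕ => (ascPochhammer ℝ k).eval (-q) / (k.factorial : ℝ) * w ^ k)
      ((1 - w) ^ q) := by
  have h := (one_div_one_sub_rpow_hasFPowerSeriesOnBall_zero (-q)).hasSum (y := w)
    (by simpa [Metric.mem_eball, edist_dist, enorm_eq_ofReal_abs] using hw)
  have hw' : 0 < 1 - w := by linarith [(abs_lt.1 hw).2]
  simp only [zero_add, Real.rpow_neg hw'.le, one_div, inv_inv] at h
  refine (congrArg (HasSum · _) (funext fun k => ?_)).mpr h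
  rw [FormalMultilinearSeries.ofScalars_apply_eq]
  have h1 : Ring.choose (-q + k - 1) k = Ring.multichoose (-q) k := by
    rw [Ring.choose]; congr 1; ring
  have h2 := Ring.factorial_nsmul_multichoose_eq_ascPochhammer (-q) k
  rw [Polynomial.ascPochhammer_smeval_eq_eval, nsmul_eq_mul] at h2
  rw [h1, ← h2, smul_eq_mul]
  field_simp

theorem Real.Gamma_add_nat_eq_ascPochhammer_mul {a : ℝ} (ha : 0 < a) (k : ℕ) :
    Gamma (a + k) = (ascPochhammer ℝ k).eval a * Gamma a := by
  induction k with
  | zero => simp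
  | succ k ih =>
    rw [Nat.cast_succ, ← add_assoc, Gamma_add_one (by positivity), ih, ascPochhammer_succ_eval]
    ring

theorem lintegral_ofReal_eq_of_integral_eq {α : Type*} [MeasurableSpace α] {μ : Measure α}
    {f : α → ℝ} {c : ℝ} (hf : 0 ≤ᵐ[μ] f) (h : ∫ x, f x ∂μ = c) (hc : c ≠ 0 ∨ f =ᵐ[μ] 0) :
    ∫⁻ x, ENNReal.ofReal (f x) ∂μ = ENNReal.ofReal c := by
  rw [← h, ofReal_integral_eq_lintegral_ofReal _ hf]
  rcases hc with hc | hc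
  · exact Integrable.of_integral_ne_zero (h ▸ hc)
  · exact (integrable_zero _ _ _).congr hc.symm

open ProbabilityTheory in
theorem integral_rpow_mul_one_sub_rpow_s19 {a b : ℝ} (ha : 0 < a) (hb : 0 < b) :
    ∫ u in Set.Ioo (0 : ℝ) 1, u ^ (a - 1) * (1 - u) ^ (b - 1) = beta a b := by
  have h := lintegral_betaPDF_eq_one ha hb
  have hβ := beta_pos ha hb
  rw [lintegral_betaPDF] at h
  have h2 : ∫ u in Set.Ioo (0 : ℝ) 1, 1 / beta a b * u ^ (a - 1) * (1 - u) ^ (b - 1) = 1 := by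
    rw [integral_eq_lintegral_of_nonneg_ae, h, ENNReal.toReal_one]
    · refine ae_restrict_of_forall_mem measurableSet_Ioo fun u hu => ?_
      have := hu.1
      have : 0 < 1 - u := sub_pos.2 hu.2
      simp only [Pi.zero_apply]
      positivity
    · exact Measurable.aestronglyMeasurable (by fun_prop)
  simp_rw [mul_assoc] at h2
  rw [integral_const_mul] at h2
  field_simp at h2
  linarith

theorem ProbabilityTheory.beta_add_nat {a b : ℝ} (ha : 0 < a) (hb : 0 < b) (k : ℕ) :
    beta (a + k) b =
      (ascPochhammer ℝ k).eval a / (ascPochhammer ℝ k).eval (a + b) * beta a b := by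
  have h1 := ascPochhammer_pos k (a + b) (by positivity)
  have h2 : 0 < Gamma (a + b) := Gamma_pos_of_pos (by positivity)
  rw [beta, beta, show a + k + b = a + b + k by ring, Gamma_add_nat_eq_ascPochhammer_mul ha,
    Gamma_add_nat_eq_ascPochhammer_mul (by positivity : 0 < a + b)]
  field_simp

theorem summable_abs_hypergeometric_term {a b q z : ℝ} (ha : 0 < a) (hab : a ≤ b) (hq : 0 < q)
    (hz0 : 0 ≤ z) (hz1 : z ≤ 1) :
    Summable (fun k : ℕ => |(ascPochhammer ℝ k).eval a * (ascPochhammer ℝ k).eval (-q) /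
      ((ascPochhammer ℝ k).eval b * (k.factorial : ℝ)) * z ^ k|) := by
  refine (summable_abs_ascPochhammer_eval_neg_div_factorial hq).of_nonneg_of_le
    (fun k => abs_nonneg _) fun k => ?_
  obtain ⟨h0, h1⟩ := ascPochhammer_eval_div_eval_mem_Icc ha hab k
  rw [mul_div_mul_comm, abs_mul, abs_mul, abs_of_nonneg h0, abs_of_nonneg (pow_nonneg hz0 k)]
  calc _ ≤ 1 * |(ascPochhammer ℝ k).eval (-q) / (k.factorial : ℝ)| * 1 := by
        gcongr
        exact pow_le_one₀ hz0 hz1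
    _ = _ := by ring

open ProbabilityTheory in
theorem integral_euler_hypergeometric {a b q z : ℝ} (ha : 0 < a) (hb : 0 < b) (hq : 0 < q)
    (hz0 : 0 ≤ z) (hz1 : z ≤ 1) :
    ∫ u in Set.Ioo (0 : ℝ) 1, u ^ (a - 1) * (1 - u) ^ (b - 1) * (1 - u * z) ^ q =
      beta a b * ∑' k : ℕ, (ascPochhammer ℝ k).eval a * (ascPochhammer ℝ k).eval (-q) /
        ((ascPochhammer ℝ k).eval (a + b) * (k.factorial : ℝ)) * z ^ k := by
  set c : ℕ → ℝ := fun k => (ascPochhammer ℝ k).eval (-q) / (k.factorial : ℝ) with hc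
  set F : ℕ → ℝ → ℝ := fun k u => c k * z ^ k * (u ^ (a + k - 1) * (1 - u) ^ (b - 1)) with hF
  have hak : ∀ k : ℕ, 0 < a + k := fun k => by positivity
  have hI : ∀ k : ℕ, ∫ u in Set.Ioo (0 : ℝ) 1, u ^ (a + k - 1) * (1 - u) ^ (b - 1) =
      beta (a + k) b := fun k => integral_rpow_mul_one_sub_rpow_s19 (hak k) hb
  have hnn : ∀ k : ℕ, ∀ u ∈ Set.Ioo (0 : ℝ) 1, 0 ≤ u ^ (a + k - 1) * (1 - u) ^ (b - 1) := by
    intro k u hu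
    have := hu.1
    have : 0 < 1 - u := sub_pos.2 hu.2
    positivity
  have hF_int : ∀ k, IntegrableOn (F k) (Set.Ioo 0 1) := fun k =>
    (Integrable.of_integral_ne_zero (by rw [hI]; exact (beta_pos (hak k) hb).ne')).const_mul _
  have hterm : ∀ k : ℕ, c k * z ^ k * beta (a + k) b =
      beta a b * ((ascPochhammer ℝ k).eval a * (ascPochhammer ℝ k).eval (-q) /
        ((ascPochhammer ℝ k).eval (a + b) * (k.factorial : ℝ)) * z ^ k) := by
    intro k
    rw [beta_add_nat ha hb, mul_div_mul_comm]
    ring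
  have hFnorm : ∀ k, ∫ u in Set.Ioo (0 : ℝ) 1, ‖F k u‖ = |c k * z ^ k * beta (a + k) b| := by
    intro k
    rw [abs_mul, abs_of_pos (beta_pos (hak k) hb), ← hI, ← integral_const_mul]
    refine setIntegral_congr_fun measurableSet_Ioo fun u hu => ?_
    simp only [hF, norm_eq_abs]
    rw [abs_mul, abs_of_nonneg (hnn k u hu)]
  have hsum := hasSum_integral_of_summable_integral_norm hF_int (by
    simp_rw [hFnorm, hterm, abs_mul (beta a b)]
    exact (summable_abs_hypergeometric_term ha (by linarith) hq hz0 hz1).mul_left _)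
  have hs2 : ∀ k, ∫ u in Set.Ioo (0 : ℝ) 1, F k u = c k * z ^ k * beta (a + k) b := by
    intro k
    rw [← hI, ← integral_const_mul]
  simp_rw [hs2, hterm] at hsum
  rw [← tsum_mul_left, hsum.tsum_eq]
  refine setIntegral_congr_fun measurableSet_Ioo fun u hu => ?_
  have hu0 := hu.1
  have huz : |u * z| < 1 := by
    rw [abs_of_nonneg (by positivity)]
    nlinarith [hu.2]
  have := (hasSum_one_sub_rpow q huz).mul_left (u ^ (a - 1) * (1 - u) ^ (b - 1))
  rw [← this.tsum_eq]
  refine tsum_congr fun k => ?_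
  simp only [hF, hc]
  rw [show a + k - 1 = a - 1 + k by ring, rpow_add_natCast hu0.ne', mul_pow]
  ring

theorem hasDerivAt_max_zero_rpow {p : ℝ} (hp : 0 < p) (t : ℝ) :
    HasDerivAt (fun t : ℝ => max t 0 ^ (p + 1)) ((p + 1) * max t 0 ^ p) t := by
  have hp1 : p + 1 ≠ 0 := by positivity
  have hpow : HasDerivAt (fun t : ℝ => t ^ (p + 1)) ((p + 1) * t ^ p) t := by
    simpa using Real.hasDerivAt_rpow_const (x := t) (p := p + 1) (Or.inr (by linarith))
  have hneg : t ≤ 0 → HasDerivWithinAt (fun t : ℝ => max t 0 ^ (p + 1))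
      ((p + 1) * max t 0 ^ p) (Set.Iic 0) t := fun ht => by
    rw [max_eq_right ht, zero_rpow hp.ne', mul_zero]
    refine (hasDerivWithinAt_const t _ (0 : ℝ)).congr_of_mem (fun x (hx : x ≤ 0) => ?_) ht
    rw [max_eq_right hx, zero_rpow hp1]
  have hpos : 0 ≤ t → HasDerivWithinAt (fun t : ℝ => max t 0 ^ (p + 1))
      ((p + 1) * max t 0 ^ p) (Set.Ici 0) t := fun ht => by
    rw [max_eq_left ht]
    refine hpow.hasDerivWithinAt.congr_of_mem (fun x (hx : 0 ≤ x) => ?_) ht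
    rw [max_eq_left hx]
  rcases lt_trichotomy t 0 with ht | rfl | ht
  · exact (hneg ht.le).hasDerivAt (Iic_mem_nhds ht)
  · simpa using (hneg le_rfl).union (hpos le_rfl)
  · exact (hpos ht.le).hasDerivAt (Ici_mem_nhds ht)

theorem hasDerivAt_integral_max_sub_rpow_mul {α : Type*} [MeasurableSpace α] {μ : Measure α}
    {φ w : α → ℝ} (hw : ∀ᵐ x ∂μ, 0 ≤ w x) {p : ℝ} (hp : 0 < p)
    (h_int : ∀ q : ℝ, 0 < q → ∀ r : ℝ, Integrable (fun x => max (r - φ x) 0 ^ q * w x) μ) (R : ℝ) :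
    HasDerivAt (fun r => ∫ x, max (r - φ x) 0 ^ (p + 1) * w x ∂μ)
      ((p + 1) * ∫ x, max (R - φ x) 0 ^ p * w x ∂μ) R := by
  rw [← integral_const_mul]
  refine (hasDerivAt_integral_of_dominated_loc_of_deriv_le (Iio_mem_nhds (lt_add_one R))
    (F' := fun r x => (p + 1) * (max (r - φ x) 0 ^ p * w x))
    (bound := fun x => (p + 1) * (max (R + 1 - φ x) 0 ^ p * w x))
    (.of_forall fun r => (h_int _ (by positivity) r).aestronglyMeasurable)
    (h_int _ (by positivity) R) ((h_int p hp R).const_mul _).aestronglyMeasurable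
    (hw.mono fun x hx r hr => ?_) ((h_int p hp (R + 1)).const_mul _)
    (.of_forall fun x r hr => ?_)).2
  · have : r ≤ R + 1 := le_of_lt hr
    rw [norm_of_nonneg (by positivity)]
    gcongr
  · have := ((hasDerivAt_max_zero_rpow hp (r - φ x)).comp_sub_const r (φ x)).mul_const (w x)
    simpa only [mul_assoc] using this

open ProbabilityTheory in
theorem integral_rpow_mul_max_sub_rpow
    {a p A B : ℝ} (ha : 0 < a) (hp : 0 < p) (hB : 0 < B) :
    ∫ t in Set.Ioi (0 : ℝ), t ^ (a - 1) * max (A - t * B) 0 ^ p =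
      max A 0 ^ (p + a) * B ^ (-a) * beta a (p + 1) := by
  rcases le_or_gt A 0 with hA | hA
  · rw [max_eq_right hA, zero_rpow (by positivity), zero_mul, zero_mul]
    refine setIntegral_eq_zero_of_forall_eq_zero fun t ht => ?_
    have : 0 < t := ht
    rw [max_eq_right (by nlinarith), zero_rpow hp.ne', mul_zero]
  have hAB : 0 < A / B := by positivity
  have h := integral_comp_mul_left_Ioi (fun t => t ^ (a - 1) * max (A - t * B) 0 ^ p) 0 hAB
  rw [mul_zero, eq_comm, smul_eq_mul, inv_mul_eq_iff_eq_mul₀ hAB.ne'] at h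
  rw [h]
  have h2 : ∫ v in Set.Ioi (0 : ℝ), (A / B * v) ^ (a - 1) * max (A - A / B * v * B) 0 ^ p =
      ∫ v in Set.Ioo (0 : ℝ) 1, (A / B) ^ (a - 1) * A ^ p * (v ^ (a - 1) * (1 - v) ^ (p + 1 - 1)) := by
    rw [setIntegral_eq_of_subset_of_forall_sdiff_eq_zero measurableSet_Ioi
      (fun v hv => hv.1 : Set.Ioo (0 : ℝ) 1 ⊆ Set.Ioi 0)]
    · refine setIntegral_congr_fun measurableSet_Ioo fun v hv => ?_
      have h1 : 0 < 1 - v := sub_pos.2 hv.2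
      have h3 : A - A / B * v * B = A * (1 - v) := by field_simp
      rw [h3, max_eq_left (by positivity), mul_rpow hAB.le hv.1.le, mul_rpow hA.le h1.le,
        add_sub_cancel_right]
      ring
    · intro v hv
      have h1 : 1 ≤ v := by
        by_contra! h
        exact hv.2 ⟨hv.1, h⟩
      have h3 : A - A / B * v * B = A * (1 - v) := by field_simp
      rw [h3, max_eq_right (by nlinarith), zero_rpow hp.ne', mul_zero]
  rw [h2, integral_const_mul, integral_rpow_mul_one_sub_rpow_s19 ha (by positivity), max_eq_left hA.le,
    rpow_sub_one hAB.ne', rpow_add hA, div_rpow hA.le hB.le, rpow_neg hB.le]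
  field_simp

open ProbabilityTheory in
theorem integral_max_sub_mul_norm_sq_rpow
    {n : ℕ} (hn : 1 ≤ n) {p A B : ℝ} (hp : 0 < p) (hB : 0 < B) :
    ∫ y : EuclideanSpace ℝ (Fin n), max (A - ‖y‖ ^ 2 * B) 0 ^ p =
      max A 0 ^ (p + n / 2) * B ^ (-(n / 2 : ℝ)) *
        (π ^ (n / 2 : ℝ) * Gamma (p + 1) / Gamma (p + n / 2 + 1)) := by
  have : Nonempty (Fin n) := ⟨⟨0, hn⟩⟩
  have hn0 : 0 < (n : ℝ) := by exact_mod_cast hn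
  have hG : 0 < Gamma ((n : ℝ) / 2) := Gamma_pos_of_pos (by positivity)
  rw [integral_fun_norm_addHaar volume (fun r : ℝ => max (A - r ^ 2 * B) 0 ^ p)]
  have h := integral_comp_rpow_Ioi_of_pos (g := fun t => t ^ ((n : ℝ) / 2 - 1) * max (A - t * B) 0 ^ p)
    (p := 2) (by norm_num)
  rw [integral_rpow_mul_max_sub_rpow (by positivity) hp hB] at h
  have h2 : ∫ r in Set.Ioi (0 : ℝ), (2 * r ^ ((2 : ℝ) - 1)) •
      ((r ^ (2 : ℝ)) ^ ((n : ℝ) / 2 - 1) * max (A - r ^ (2 : ℝ) * B) 0 ^ p) =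
      2 * ∫ r in Set.Ioi (0 : ℝ), r ^ (n - 1) • max (A - r ^ 2 * B) 0 ^ p := by
    rw [← integral_const_mul]
    refine setIntegral_congr_fun measurableSet_Ioi fun r (hr : 0 < r) => ?_
    simp only [smul_eq_mul]
    rw [← rpow_mul hr.le, ← rpow_natCast r (n - 1), Nat.cast_pred hn, rpow_two,
      show (n : ℝ) - 1 = (2 - 1) + 2 * (n / 2 - 1) by ring, rpow_add hr]
    ring
  rw [h2, mul_comm, ← eq_div_iff two_ne_zero] at h
  rw [finrank_euclideanSpace_fin, h, measureReal_def, EuclideanSpace.volume_ball, Fintype.card_fin,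
    Gamma_add_one (by positivity), ENNReal.ofReal_one, one_pow, one_mul,
    ENNReal.toReal_ofReal (by positivity), nsmul_eq_mul, smul_eq_mul, beta, sqrt_eq_rpow,
    ← rpow_mul_natCast pi_nonneg, show 1 / 2 * (n : ℝ) = n / 2 by ring,
    show (n : ℝ) / 2 + (p + 1) = p + n / 2 + 1 by ring]
  field_simp

theorem image_div_one_sub_Ioo :
    (fun u : ℝ => u / (1 - u)) '' Set.Ioo 0 1 = Set.Ioi 0 := by
  ext t
  constructor
  · rintro ⟨u, hu, rfl⟩
    exact div_pos hu.1 (sub_pos.2 hu.2)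
  · intro (ht : 0 < t)
    refine ⟨t / (1 + t), ⟨by positivity, (div_lt_one (by positivity)).2 (by linarith)⟩, ?_⟩
    have : 1 - t / (1 + t) = 1 / (1 + t) := by field_simp; ring
    simp only [this]
    field_simp

theorem lintegral_Ioi_eq_lintegral_Ioo_div_one_sub (g : ℝ → ENNReal) :
    ∫⁻ t in Set.Ioi (0 : ℝ), g t =
      ∫⁻ u in Set.Ioo (0 : ℝ) 1, ENNReal.ofReal (1 / (1 - u) ^ 2) * g (u / (1 - u)) := by
  rw [← image_div_one_sub_Ioo, lintegral_image_eq_lintegral_abs_deriv_mul measurableSet_Ioo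
    (f' := fun u => 1 / (1 - u) ^ 2) (fun u hu => ?_) (fun u hu v hv huv => ?_)]
  · simp_rw [abs_of_nonneg (one_div_nonneg.2 (sq_nonneg (1 - _ : ℝ)))]
  · have h1 : 1 - u ≠ 0 := (sub_pos.2 hu.2).ne'
    have := (hasDerivAt_id u).div ((hasDerivAt_id u).const_sub 1) h1
    convert! this.hasDerivWithinAt using 1
    simp
  · have h1 : 1 - u ≠ 0 := (sub_pos.2 hu.2).ne'
    have h2 : 1 - v ≠ 0 := (sub_pos.2 hv.2).ne'
    rw [div_eq_div_iff h1 h2] at huv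
    linarith

theorem sub_norm_sq_sub_mul_norm_sub_sq {E : Type*} [NormedAddCommGroup E] [InnerProductSpace ℝ E]
    {t : ℝ} (ht : 0 < t) (R : ℝ) (x y : E) :
    R - ‖y‖ ^ 2 - t * ‖x - y‖ ^ 2 =
      R - t / (1 + t) * ‖x‖ ^ 2 - ‖y - (t / (1 + t)) • x‖ ^ 2 * (1 + t) := by
  rw [norm_sub_sq_real, norm_sub_sq_real, inner_smul_right, norm_smul, mul_pow, norm_eq_abs, sq_abs,
    real_inner_comm]
  field_simp
  ring

theorem lintegral_max_sub_norm_sq_sub_rpow {n : ℕ} (hn : 1 ≤ n) {p t : ℝ} (hp : 0 < p)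
    (ht : 0 < t) (R : ℝ) (x : EuclideanSpace ℝ (Fin n)) :
    ∫⁻ y, ENNReal.ofReal (max (R - ‖y‖ ^ 2 - t * ‖x - y‖ ^ 2) 0 ^ p) =
      ENNReal.ofReal (max (R - t / (1 + t) * ‖x‖ ^ 2) 0 ^ (p + n / 2) *
        (1 + t) ^ (-(n / 2 : ℝ)) * (π ^ (n / 2 : ℝ) * Gamma (p + 1) / Gamma (p + n / 2 + 1))) := by
  have hΓ : 0 < Gamma (p + 1) := Gamma_pos_of_pos (by positivity)
  have hΓ' : 0 < Gamma (p + n / 2 + 1) := Gamma_pos_of_pos (by positivity)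
  simp_rw [sub_norm_sq_sub_mul_norm_sub_sq ht]
  set A := R - t / (1 + t) * ‖x‖ ^ 2
  refine lintegral_ofReal_eq_of_integral_eq (.of_forall fun y => by positivity) ?_ ?_
  · rw [integral_sub_right_eq_self (fun y => max (A - ‖y‖ ^ 2 * (1 + t)) 0 ^ p),
      integral_max_sub_mul_norm_sq_rpow hn hp (by positivity)]
  · rcases le_or_gt A 0 with hA | hA
    · refine .inr (.of_forall fun y => ?_)
      simp only [Pi.zero_apply]
      rw [max_eq_right, zero_rpow hp.ne']
      have : 0 ≤ ‖y - (t / (1 + t)) • x‖ ^ 2 * (1 + t) := by positivity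
      linarith
    · left
      rw [max_eq_left hA.le]
      positivity

open ProbabilityTheory in
theorem lintegral_rpow_mul_max_sub_rpow {a p A B : ℝ} (ha : 0 < a) (hp : 0 < p) (hB : 0 < B) :
    ∫⁻ t in Set.Ioi (0 : ℝ), ENNReal.ofReal (t ^ (a - 1) * max (A - t * B) 0 ^ p) =
      ENNReal.ofReal (max A 0 ^ (p + a) * B ^ (-a) * beta a (p + 1)) := by
  have hβ := beta_pos ha (add_pos hp one_pos)
  refine lintegral_ofReal_eq_of_integral_eq
    (ae_restrict_of_forall_mem measurableSet_Ioi fun t (ht : 0 < t) => ?_)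
    (integral_rpow_mul_max_sub_rpow ha hp hB) ?_
  · simp only [Pi.zero_apply]
    positivity
  · rcases le_or_gt A 0 with hA | hA
    · refine .inr (ae_restrict_of_forall_mem measurableSet_Ioi fun t (ht : 0 < t) => ?_)
      simp only [Pi.zero_apply]
      rw [max_eq_right (by nlinarith), zero_rpow hp.ne', mul_zero]
    · left
      rw [max_eq_left hA.le]
      positivity

open ProbabilityTheory in
theorem lintegral_max_sub_norm_sq_rpow_mul_norm_sub_rpow {n : ℕ} (hn : 1 ≤ n) {a p s : ℝ}
    (ha : 0 < a) (hp : 0 < p) (has : a + s = n / 2) (R : ℝ) (x : EuclideanSpace ℝ (Fin n)) :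
    ∫⁻ y, ENNReal.ofReal (max (R - ‖y‖ ^ 2) 0 ^ (p + a) * ‖x - y‖ ^ (-(2 * a)) *
        beta a (p + 1)) =
      ∫⁻ u in Set.Ioo (0 : ℝ) 1, ENNReal.ofReal (max (R - u * ‖x‖ ^ 2) 0 ^ (p + a + s) *
        (u ^ (a - 1) * (1 - u) ^ (s - 1)) *
        (π ^ (n / 2 : ℝ) * Gamma (p + 1) / Gamma (p + a + s + 1))) := by
  have : Nonempty (Fin n) := ⟨⟨0, hn⟩⟩
  have h1 : ∫⁻ y, ENNReal.ofReal (max (R - ‖y‖ ^ 2) 0 ^ (p + a) * ‖x - y‖ ^ (-(2 * a)) *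
        beta a (p + 1)) =
      ∫⁻ y, ∫⁻ t in Set.Ioi (0 : ℝ), ENNReal.ofReal (t ^ (a - 1) *
        max (R - ‖y‖ ^ 2 - t * ‖x - y‖ ^ 2) 0 ^ p) := by
    refine lintegral_congr_ae ?_
    filter_upwards [compl_mem_ae_iff.2 (measure_singleton x)] with y hy
    have hxy : 0 < ‖x - y‖ := norm_pos_iff.2 (sub_ne_zero.2 (Ne.symm hy))
    rw [lintegral_rpow_mul_max_sub_rpow ha hp (by positivity),
      show (‖x - y‖ ^ 2) ^ (-a) = ‖x - y‖ ^ (-(2 * a)) by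
        rw [← rpow_two, ← rpow_mul hxy.le, mul_neg]]
  rw [h1, lintegral_lintegral_swap (by unfold Function.uncurry; fun_prop),
    lintegral_Ioi_eq_lintegral_Ioo_div_one_sub]
  refine setLIntegral_congr_fun measurableSet_Ioo fun u hu => ?_
  have hu0 := hu.1
  have hu1 : 0 < 1 - u := sub_pos.2 hu.2
  have ht : 0 < u / (1 - u) := by positivity
  have ht1 : 1 + u / (1 - u) = (1 - u)⁻¹ := by field_simp; ring
  have ht2 : u / (1 - u) / (1 - u)⁻¹ = u := by field_simp
  simp_rw [ENNReal.ofReal_mul (rpow_nonneg ht.le (a - 1))]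
  rw [lintegral_const_mul _ (by fun_prop), lintegral_max_sub_norm_sq_sub_rpow hn hp ht, ht1, ht2,
    ← ENNReal.ofReal_mul (by positivity), ← ENNReal.ofReal_mul (by positivity), ← has,
    ← add_assoc p a s, inv_rpow hu1.le, rpow_neg hu1.le, inv_inv, div_rpow hu0.le hu1.le]
  congr 1
  have h2 : (1 - u) ^ (a + s) = (1 - u) ^ (s - 1) * (1 - u) ^ (a - 1) * (1 - u) ^ 2 := by
    rw [← rpow_two, ← rpow_add hu1, ← rpow_add hu1]
    ring_nf
  rw [h2]
  field_simp

theorem integrable_max_sub_norm_sq_rpow_mul_norm_sub_rpow {n : ℕ} (hn : 1 ≤ n) {α q : ℝ}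
    (hα : α < n) (hq : 0 < q) (R : ℝ) (x : EuclideanSpace ℝ (Fin n)) :
    Integrable fun y => max (R - ‖y‖ ^ 2) 0 ^ q * ‖x - y‖ ^ (-α) := by
  have hloc : LocallyIntegrable (fun z : EuclideanSpace ℝ (Fin n) => ‖z‖ ^ (-α)) :=
    locallyIntegrable_of_norm_le_rpow (C := 1) (α := α) (by simpa using hn) (by simpa using hα)
      (.of_forall fun z => by rw [one_mul, norm_of_nonneg (by positivity)])
      (Measurable.aestronglyMeasurable (by fun_prop))
  have hcont : Continuous fun z : EuclideanSpace ℝ (Fin n) => max (R - ‖x - z‖ ^ 2) 0 ^ q :=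
    Continuous.rpow_const (by fun_prop) fun _ => .inr hq.le
  have hsupp : HasCompactSupport fun z : EuclideanSpace ℝ (Fin n) =>
      max (R - ‖x - z‖ ^ 2) 0 ^ q := by
    refine HasCompactSupport.intro (isCompact_closedBall x (|R| + 1)) fun z hz => ?_
    have h1 : |R| + 1 < ‖x - z‖ := by
      simpa [Metric.mem_closedBall, dist_eq_norm_sub'] using hz
    rw [max_eq_right, zero_rpow hq.ne']
    nlinarith [le_abs_self R, abs_nonneg R]
  simpa using (hloc.integrable_smul_left_of_hasCompactSupport hcont hsupp).comp_sub_left x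

open ProbabilityTheory in
theorem integrableOn_max_sub_mul_rpow_mul_beta {a s q z : ℝ} (ha : 0 < a) (hs : 0 < s)
    (hq : 0 < q) (hz : 0 ≤ z) (R : ℝ) :
    IntegrableOn (fun u => max (R - u * z) 0 ^ q * (u ^ (a - 1) * (1 - u) ^ (s - 1)))
      (Set.Ioo 0 1) := by
  refine Integrable.bdd_mul (c := max R 0 ^ q) ?_
    (Measurable.aestronglyMeasurable (by fun_prop)) ?_
  · exact Integrable.of_integral_ne_zero
      (by rw [integral_rpow_mul_one_sub_rpow_s19 ha hs]; exact (beta_pos ha hs).ne')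
  · refine ae_restrict_of_forall_mem measurableSet_Ioo fun u hu => ?_
    rw [norm_of_nonneg (by positivity)]
    have := mul_nonneg hu.1.le hz
    gcongr
    linarith

/-- The Riesz potential of `(R - ‖y‖²)₊ ^ β` as a one-dimensional Euler-type integral. -/
theorem integral_max_sub_norm_sq_rpow_mul_norm_sub_rpow {n : ℕ} (hn : 1 ≤ n) {a s β : ℝ}
    (ha : 0 < a) (hs : 0 < s) (hβ : 0 < β) (has : a + s = n / 2) (R : ℝ)
    (x : EuclideanSpace ℝ (Fin n)) :
    Gamma a * Gamma (β + s + 1) * ∫ y, max (R - ‖y‖ ^ 2) 0 ^ β * ‖x - y‖ ^ (-(2 * a)) =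
      π ^ (n / 2 : ℝ) * Gamma (β + 1) *
        ∫ u in Set.Ioo (0 : ℝ) 1, max (R - u * ‖x‖ ^ 2) 0 ^ (β + s) *
          (u ^ (a - 1) * (1 - u) ^ (s - 1)) := by
  obtain ⟨m, hm⟩ := exists_nat_gt (a - β)
  induction m generalizing β R with
  | zero =>
    obtain ⟨p, rfl⟩ : ∃ p, β = p + a := ⟨β - a, by ring⟩
    have hp : 0 < p := by simpa using hm
    have h := congrArg ENNReal.toReal
      (lintegral_max_sub_norm_sq_rpow_mul_norm_sub_rpow hn ha hp has R x)
    have hΓ : 0 < Gamma (p + 1) := Gamma_pos_of_pos (by positivity)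
    have hΓ' : 0 < Gamma (p + a + s + 1) := Gamma_pos_of_pos (by positivity)
    have hΓ'' : 0 < Gamma (p + a + 1) := Gamma_pos_of_pos (by positivity)
    have hb := ProbabilityTheory.beta_pos ha (add_pos hp one_pos)
    rw [← integral_eq_lintegral_of_nonneg_ae, ← integral_eq_lintegral_of_nonneg_ae,
      integral_mul_const, integral_mul_const, ProbabilityTheory.beta,
      show a + (p + 1) = p + a + 1 by ring] at h
    · generalize (∫ y, max (R - ‖y‖ ^ 2) 0 ^ (p + a) * ‖x - y‖ ^ (-(2 * a))) = I at h ⊢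
      generalize (∫ u in Set.Ioo (0 : ℝ) 1, max (R - u * ‖x‖ ^ 2) 0 ^ (p + a + s) *
        (u ^ (a - 1) * (1 - u) ^ (s - 1))) = J at h ⊢
      field_simp at h
      linear_combination h
    · refine ae_restrict_of_forall_mem measurableSet_Ioo fun u hu => ?_
      have := hu.1
      have : 0 < 1 - u := sub_pos.2 hu.2
      simp only [Pi.zero_apply]
      positivity
    · exact Measurable.aestronglyMeasurable (by fun_prop)
    · exact .of_forall fun y => by simp only [Pi.zero_apply]; positivity
    · exact Measurable.aestronglyMeasurable (by fun_prop)
  | succ m ih =>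
    have hF := hasDerivAt_integral_max_sub_rpow_mul (μ := volume)
      (φ := fun y : EuclideanSpace ℝ (Fin n) => ‖y‖ ^ 2) (w := fun y => ‖x - y‖ ^ (-(2 * a)))
      (.of_forall fun y => by positivity) hβ
      (fun q hq r => integrable_max_sub_norm_sq_rpow_mul_norm_sub_rpow hn (by linarith) hq r x) R
    have hG := hasDerivAt_integral_max_sub_rpow_mul (μ := volume.restrict (Set.Ioo (0 : ℝ) 1))
      (φ := fun u => u * ‖x‖ ^ 2) (w := fun u => u ^ (a - 1) * (1 - u) ^ (s - 1))
      (ae_restrict_of_forall_mem measurableSet_Ioo fun u hu => by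
        have := hu.1
        have : 0 < 1 - u := sub_pos.2 hu.2
        positivity) (add_pos hβ hs)
      (fun q hq r => integrableOn_max_sub_mul_rpow_mul_beta ha hs hq (by positivity) r) R
    have h := ((hF.const_mul (Gamma a * Gamma (β + 1 + s + 1))).congr_of_eventuallyEq
      (.of_forall fun r => (ih (by positivity) r (by push_cast at hm; linarith)).symm)).unique
      (by simpa only [add_right_comm β 1 s] using
        hG.const_mul (π ^ (n / 2 : ℝ) * Gamma (β + 1 + 1)))
    rw [Gamma_add_one (s := β + 1) (by positivity), add_right_comm β 1 s,
      Gamma_add_one (s := β + s + 1) (by positivity)] at h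
    have h1 : 0 < β + 1 := by positivity
    have h2 : 0 < β + s + 1 := by positivity
    refine mul_left_cancel₀ (mul_pos h1 h2).ne' ?_
    linear_combination h

theorem riesz_potential_of_truncated_power (n : ℕ) (hn : 1 ≤ n) (s γ : ℝ)
    (hs : 0 < s) (hsn : 2 * s < (n : ℝ)) (hγ : 0 < γ)
    (x : EuclideanSpace ℝ (Fin n)) (hx : ‖x‖ ≤ 1) :
    Summable (fun k : ℕ =>
      |(ascPochhammer ℝ k).eval (((n : ℝ) - 2 * s) / 2) *
          (ascPochhammer ℝ k).eval (-(γ + 2 * s) / 2) /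
          (((ascPochhammer ℝ k).eval ((n : ℝ) / 2)) * (k.factorial : ℝ)) * ‖x‖ ^ (2 * k)|) ∧
    (Real.Gamma (((n : ℝ) - 2 * s) / 2) / (4 ^ s * Real.pi ^ ((n : ℝ) / 2) * Real.Gamma s)) *
        (∫ y : EuclideanSpace ℝ (Fin n),
          (max (1 - ‖y‖ ^ 2) 0) ^ (γ / 2) * ‖x - y‖ ^ (2 * s - (n : ℝ))) =
      (2 ^ (-(2 * s)) * Real.Gamma (((n : ℝ) - 2 * s) / 2) * Real.Gamma (γ / 2 + 1) /
          (Real.Gamma ((2 * s + γ) / 2 + 1) * Real.Gamma ((n : ℝ) / 2))) *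
        ∑' k : ℕ,
          (ascPochhammer ℝ k).eval (((n : ℝ) - 2 * s) / 2) *
            (ascPochhammer ℝ k).eval (-(γ + 2 * s) / 2) /
            (((ascPochhammer ℝ k).eval ((n : ℝ) / 2)) * (k.factorial : ℝ)) * ‖x‖ ^ (2 * k) := by
  have ha : 0 < ((n : ℝ) - 2 * s) / 2 := by linarith
  have hq : 0 < (γ + 2 * s) / 2 := by positivity
  have hz1 : ‖x‖ ^ 2 ≤ 1 := pow_le_one₀ (norm_nonneg x) hx
  simp_rw [neg_div, pow_mul]
  refine ⟨summable_abs_hypergeometric_term ha (by linarith) hq (by positivity) hz1, ?_⟩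
  have h1 := integral_max_sub_norm_sq_rpow_mul_norm_sub_rpow hn ha hs (half_pos hγ) (by ring) 1 x
  have h2 := integral_euler_hypergeometric ha hs hq (sq_nonneg ‖x‖) hz1
  rw [show ((n : ℝ) - 2 * s) / 2 + s = n / 2 by ring] at h2
  have h3 : ∫ u in Set.Ioo (0 : ℝ) 1, max (1 - u * ‖x‖ ^ 2) 0 ^ (γ / 2 + s) *
        (u ^ (((n : ℝ) - 2 * s) / 2 - 1) * (1 - u) ^ (s - 1)) =
      ∫ u in Set.Ioo (0 : ℝ) 1, u ^ (((n : ℝ) - 2 * s) / 2 - 1) * (1 - u) ^ (s - 1) *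
        (1 - u * ‖x‖ ^ 2) ^ ((γ + 2 * s) / 2) := by
    refine setIntegral_congr_fun measurableSet_Ioo fun u hu => ?_
    have : u * ‖x‖ ^ 2 ≤ 1 := mul_le_one₀ hu.2.le (sq_nonneg _) hz1
    rw [max_eq_left (by linarith), show γ / 2 + s = (γ + 2 * s) / 2 by ring, mul_comm]
  rw [h3, h2, ProbabilityTheory.beta, show ((n : ℝ) - 2 * s) / 2 + s = n / 2 by ring,
    show -(2 * (((n : ℝ) - 2 * s) / 2)) = 2 * s - n by ring] at h1
  have hn0 : 0 < (n : ℝ) := by linarith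
  have hG1 : 0 < Gamma s := Gamma_pos_of_pos hs
  have hG2 : 0 < Gamma (((n : ℝ) - 2 * s) / 2) := Gamma_pos_of_pos ha
  have hG3 : 0 < Gamma ((n : ℝ) / 2) := Gamma_pos_of_pos (by positivity)
  have hG4 : 0 < Gamma ((2 * s + γ) / 2 + 1) := Gamma_pos_of_pos (by positivity)
  have h4 : (2 : ℝ) ^ (-(2 * s)) = (4 ^ s)⁻¹ := by
    rw [rpow_neg two_pos.le, rpow_mul two_pos.le, rpow_two]
    norm_num
  rw [show γ / 2 + s + 1 = (2 * s + γ) / 2 + 1 by ring] at h1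
  rw [h4]
  generalize (∫ y : EuclideanSpace ℝ (Fin n),
    max (1 - ‖y‖ ^ 2) 0 ^ (γ / 2) * ‖x - y‖ ^ (2 * s - (n : ℝ))) = I at h1 ⊢
  generalize (∑' k : ℕ, (_ : ℝ)) = S at h1 ⊢
  have h5 : (4 : ℝ) ^ s ≠ 0 := by positivity
  have h6 : π ^ ((n : ℝ) / 2) ≠ 0 := by positivity
  field_simp at h1 ⊢
  linear_combination h1
end
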